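/- arXiv:1310.6887 — 5 statements merged into one kernel-verified Lean document; each statement's English description precedes it below -/
import Mathlib

section
/- Let G be a finite directed acyclic multigraph with distinguished vertices s ≠ t, and let f : A → ℕ be an integer flow of value z, i.e., flow conservation holds at every vertex other than s and t, the net outflow at s equals z, and the net inflow at t equals z. Then there exists a multiset 𝒫 of exactly z directed paths from s to t such that, for every arc a, the number of paths of 𝒫 (counted with multiplicity) that traverse a equals f(a). -/
/-- A finite directed multigraph: vertex type `V`, arc type `A`, tail and head maps. -/
structure Multigraph (V A : Type) where
  tail : A → V
  head : A → V

/-- `G.Walk u v p` : the list of arcs `p` is a directed path/walk from `u` to `v`. -/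
inductive Multigraph.Walk {V A : Type} (G : Multigraph V A) : V → V → List A → Prop
  | nil (v : V) : G.Walk v v []
  | cons {u v w : V} {a : A} {p : List A} (ht : G.tail a = u) (hh : G.head a = v)
      (hp : G.Walk v w p) : G.Walk u w (a :: p)

theorem walk_balance {V A : Type} [Fintype A] [DecidableEq V] [DecidableEq A]
    (G : Multigraph V A) {u w : V} {p : List A} (h : G.Walk u w p) (v : V) :
    ∑ a ∈ Finset.univ.filter (fun a => G.tail a = v), p.count a + (if v = w then 1 else 0)
      = ∑ a ∈ Finset.univ.filter (fun a => G.head a = v), p.count a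
        + (if v = u then 1 else 0) := by
  induction h with
  | nil x => simp
  | @cons u x w a p ht hh hp ih =>
    subst ht hh
    simp only [List.count_cons, Finset.sum_add_distrib, beq_iff_eq, Finset.sum_ite_eq,
      Finset.mem_filter, Finset.mem_univ, true_and]
    simp only [eq_comm (a := v)] at ih ⊢
    omega

theorem walk_split {V A : Type} (G : Multigraph V A) {a : A} {q : List A} :
    ∀ {p : List A} {u w : V}, G.Walk u w (p ++ a :: q) → G.Walk u (G.tail a) p
  | [], u, w, h => by
    cases h with
    | cons ht hh hp => subst ht; exact .nil _
  | b :: p, u, w, h => by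
    cases h with
    | cons ht hh hp => exact .cons ht hh (walk_split G hp)

theorem walk_nodup {V A : Type} (G : Multigraph V A)
    (hacyc : ∀ (v : V) (p : List A), G.Walk v v p → p = []) {u w : V} {p : List A}
    (h : G.Walk u w p) : p.Nodup := by
  induction h with
  | nil x => simp
  | @cons u x w a p ht hh hp ih =>
    refine List.nodup_cons.2 ⟨fun hm => ?_, ih⟩
    obtain ⟨p1, p2, rfl⟩ := List.append_of_mem hm
    have := hacyc _ _ (Multigraph.Walk.cons rfl hh (walk_split G hp))
    simp at this

theorem walk_append {V A : Type} (G : Multigraph V A) {u v w : V} {p q : List A}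
    (h : G.Walk u v p) (h2 : G.Walk v w q) : G.Walk u w (p ++ q) := by
  induction h with
  | nil x => exact h2
  | cons ht hh hp ih => exact .cons ht hh (ih h2)

theorem arc_wf {V A : Type} [Fintype V] (G : Multigraph V A)
    (hacyc : ∀ (v : V) (p : List A), G.Walk v v p → p = []) :
    WellFounded (fun v u : V => ∃ a, G.tail a = u ∧ G.head a = v) := by
  let R : V → V → Prop := fun v u => ∃ p, p ≠ [] ∧ G.Walk u v p
  have : IsTrans V R := ⟨by
    rintro a b c ⟨p, hp, h⟩ ⟨q, hq, h'⟩
    exact ⟨q ++ p, by simp [hp], walk_append G h' h⟩⟩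
  have : Std.Irrefl R := ⟨by
    rintro a ⟨p, hp, h⟩
    exact hp (hacyc _ _ h)⟩
  have hw : WellFounded R := Finite.wellFounded_of_trans_of_irrefl R
  refine Subrelation.wf ?_ hw
  rintro v u ⟨a, h1, h2⟩
  exact ⟨[a], by simp, .cons h1 h2 (.nil _)⟩

/-- Integer flow decomposition in a finite DAG: an integer flow of value `z` decomposes
into a multiset of exactly `z` directed `s`–`t` paths whose arc-traversal counts
(with multiplicity) reproduce the flow on every arc. -/
theorem integer_flow_decomposition {V A : Type} [Fintype V] [Fintype A]
    [DecidableEq V] [DecidableEq A]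
    (G : Multigraph V A) (s t : V) (hst : s ≠ t)
    (hacyc : ∀ (v : V) (p : List A), G.Walk v v p → p = [])
    (f : A → ℕ) (z : ℕ)
    (hcons : ∀ v : V, v ≠ s → v ≠ t →
      ∑ a ∈ Finset.univ.filter (fun a => G.head a = v), f a
        = ∑ a ∈ Finset.univ.filter (fun a => G.tail a = v), f a)
    (hsrc : ∑ a ∈ Finset.univ.filter (fun a => G.tail a = s), f a
        = ∑ a ∈ Finset.univ.filter (fun a => G.head a = s), f a + z)
    (htgt : ∑ a ∈ Finset.univ.filter (fun a => G.head a = t), f a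
        = ∑ a ∈ Finset.univ.filter (fun a => G.tail a = t), f a + z) :
    ∃ P : Multiset (List A), Multiset.card P = z ∧
      (∀ p ∈ P, G.Walk s t p) ∧
      (∀ a : A, (P.map (fun p => p.count a)).sum = f a) := by
  have hwf := arc_wf G hacyc
  have hpos : ∀ (f : A → ℕ) (a : A), 0 < f a →
      0 < ∑ b ∈ Finset.univ.filter (fun b => G.head b = G.head a), f b := fun f a ha =>
    Finset.sum_pos' (fun _ _ => Nat.zero_le _) ⟨a, by simp, ha⟩
  have hex : ∀ (f : A → ℕ) (v : V),
      0 < ∑ b ∈ Finset.univ.filter (fun b => G.tail b = v), f b →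
      ∃ a, G.tail a = v ∧ 0 < f a := by
    intro f v h
    obtain ⟨a, ha, h0⟩ := Finset.exists_ne_zero_of_sum_ne_zero h.ne'
    exact ⟨a, by simpa using ha, Nat.pos_of_ne_zero h0⟩
  induction z generalizing f with
  | zero =>
    have hno : ∀ v : V, ∀ a, G.tail a = v → f a = 0 := by
      intro v
      induction v using hwf.induction with
      | _ v ih =>
        intro a ha
        by_contra hne
        have h1 := hpos f a (Nat.pos_of_ne_zero hne)
        have h2 : 0 < ∑ b ∈ Finset.univ.filter (fun b => G.tail b = G.head a), f b := by
          by_cases hs : G.head a = s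
          · rw [hs] at h1 ⊢; omega
          by_cases ht : G.head a = t
          · rw [ht] at h1 ⊢; omega
          rw [← hcons _ hs ht]; exact h1
        obtain ⟨b, hb, hb0⟩ := hex f _ h2
        have := ih _ ⟨a, ha, rfl⟩ b hb
        omega
    exact ⟨0, rfl, by simp, fun a => by simp [hno _ a rfl]⟩
  | succ z ih =>
    have hpath : ∀ u : V, (u = t ∨ 0 < ∑ b ∈ Finset.univ.filter (fun b => G.tail b = u), f b) →
        ∃ p, G.Walk u t p ∧ ∀ a ∈ p, 0 < f a := by
      intro u
      induction u using hwf.induction with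
      | _ u ihu =>
        intro hu
        by_cases hut : u = t
        · subst hut; exact ⟨[], .nil _, by simp⟩
        obtain ⟨a, ha, ha0⟩ := hex f u (hu.resolve_left hut)
        have h1 := hpos f a ha0
        have h2 : G.head a = t ∨
            0 < ∑ b ∈ Finset.univ.filter (fun b => G.tail b = G.head a), f b := by
          by_cases ht : G.head a = t
          · exact Or.inl ht
          right
          by_cases hs : G.head a = s
          · rw [hs] at h1 ⊢; omega
          rw [← hcons _ hs ht]; exact h1
        obtain ⟨p, hp, hp0⟩ := ihu _ ⟨a, ha, rfl⟩ h2
        refine ⟨a :: p, .cons ha rfl hp, ?_⟩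
        intro b hb
        rcases List.mem_cons.1 hb with rfl | hb
        · exact ha0
        · exact hp0 b hb
    obtain ⟨p, hp, hp0⟩ := hpath s (Or.inr (by omega))
    have hle : ∀ a, p.count a ≤ f a := by
      intro a
      by_cases ha : a ∈ p
      · have := List.nodup_iff_count_le_one.1 (walk_nodup G hacyc hp) a
        have := hp0 a ha
        omega
      · simp [List.count_eq_zero_of_not_mem ha]
    obtain ⟨g, rfl⟩ : ∃ g : A → ℕ, f = fun a => g a + p.count a :=
      ⟨fun a => f a - p.count a, by funext a; have := hle a; simp; omega⟩
    have hbal := walk_balance G hp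
    simp only [Finset.sum_add_distrib] at hcons hsrc htgt
    obtain ⟨P, hc, hw, hcount⟩ := ih g
      (fun v hs ht => by
        have h1 := hcons v hs ht
        have h2 := hbal v
        simp only [hs, ht, if_false] at h2
        omega)
      (by
        have h2 := hbal s
        simp only [hst, if_false, if_true] at h2
        omega)
      (by
        have h2 := hbal t
        simp only [hst.symm, if_false, if_true] at h2
        omega)
    refine ⟨p ::ₘ P, by simp [hc], ?_, ?_⟩
    · intro q hq
      rcases Multiset.mem_cons.1 hq with rfl | hq
      · exact hp
      · exact hw q hq
    · intro a
      simp only [Multiset.map_cons, Multiset.sum_cons, hcount a]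
      omega
end

section
/- Let V be a finite set and A ⊆ V × V × {1, …, m} a set of labeled arcs. Define the leveled graph G′ on vertex set V × {1, …, m} with an item arc from (u, i) to (v, i) labeled i for every (u, v, i) ∈ A, and a loss arc from (v, i) to (v, i+1) for every v ∈ V and every 1 ≤ i < m. Then for every directed path v₀ →^{i₁} v₁ →^{i₂} ⋯ →^{i_k} v_k in (V, A) whose label sequence is non-decreasing (i₁ ≤ i₂ ≤ ⋯ ≤ i_k), there exists a directed path in G′ from (v₀, i₁) to (v_k, i_k) whose sequence of item-arc labels, ignoring loss arcs, is exactly i₁, i₂, …, i_k. Hence no valid packing pattern respecting the item order is removed by breaking symmetry with levels. -/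
/-- `ArcPath E u v p` : the list `p` of labeled arcs `(tail, head, label)`, all belonging
to `E`, forms a directed path from `u` to `v`. -/
inductive ArcPath {α : Type} (E : Set (α × α × ℕ)) : α → α → List (α × α × ℕ) → Prop
  | nil (v : α) : ArcPath E v v []
  | cons {u v w : α} {i : ℕ} {p : List (α × α × ℕ)} (h : (u, v, i) ∈ E)
      (hp : ArcPath E v w p) : ArcPath E u w ((u, v, i) :: p)

theorem loss_extend {V : Type} (m : ℕ) (A' : Set ((V × ℕ) × (V × ℕ) × ℕ))
    (hl : ∀ (v : V) (i : ℕ), 1 ≤ i → i < m → ((v, i), (v, i + 1), 0) ∈ A')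
    (w : V) (x : V × ℕ) (d : ℕ) : ∀ (i : ℕ) (q : List ((V × ℕ) × (V × ℕ) × ℕ)),
    1 ≤ i → i + d ≤ m → ArcPath A' (w, i + d) x q →
    ∃ q', ArcPath A' (w, i) x q' ∧
      (q'.map (fun x => x.2.2)).filter (fun n => decide (n ≠ 0)) =
      (q.map (fun x => x.2.2)).filter (fun n => decide (n ≠ 0)) := by
  induction d with
  | zero => intro i q _ _ h; exact ⟨q, h, rfl⟩
  | succ d ih =>
    intro i q h1 h2 h
    have e : i + (d + 1) = i + 1 + d := by omega
    rw [e] at h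
    obtain ⟨q', hq, he⟩ := ih (i + 1) q (by omega) (by omega) h
    refine ⟨_, ArcPath.cons (hl w i h1 (by omega)) hq, ?_⟩
    rw [← he]
    simp

/-- Breaking symmetry with levels removes no pattern respecting the item order: for every
directed path in `(V, A)` with a non-decreasing label sequence `i₁ ≤ ⋯ ≤ i_k`, there is a
directed path in the leveled graph `A'` from `(v₀, i₁)` to `(v_k, i_k)` whose sequence of
item-arc labels (ignoring loss arcs, labeled `0`) is exactly `i₁, …, i_k`. -/
theorem level_graph_preserves_ordered_patterns {V : Type} [Fintype V] (m : ℕ)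
    (A : Set (V × V × ℕ)) (hA : ∀ x ∈ A, 1 ≤ x.2.2 ∧ x.2.2 ≤ m)
    (A' : Set ((V × ℕ) × (V × ℕ) × ℕ))
    (hA' : A' = {y | (∃ u v i, (u, v, i) ∈ A ∧ y = ((u, i), (v, i), i)) ∨
                     (∃ v : V, ∃ i : ℕ, 1 ≤ i ∧ i < m ∧ y = ((v, i), (v, i + 1), 0))})
    (p : List (V × V × ℕ)) (u v : V)
    (hp : ArcPath A u v p) (hne : p ≠ [])
    (hmono : List.Chain' (· ≤ ·) (p.map (fun x => x.2.2)))
    (i₁ ik : ℕ)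
    (hfirst : (p.map (fun x => x.2.2)).head? = some i₁)
    (hlast : (p.map (fun x => x.2.2)).getLast? = some ik) :
    ∃ q : List ((V × ℕ) × (V × ℕ) × ℕ),
      ArcPath A' (u, i₁) (v, ik) q ∧
      (q.map (fun x => x.2.2)).filter (fun n => decide (n ≠ 0))
        = p.map (fun x => x.2.2) := by
  have hl : ∀ (v : V) (i : ℕ), 1 ≤ i → i < m → ((v, i), (v, i + 1), 0) ∈ A' := by
    intro v i h1 h2
    rw [hA']
    exact Or.inr ⟨v, i, h1, h2, rfl⟩
  have hi : ∀ (u v : V) (i : ℕ), (u, v, i) ∈ A → ((u, i), (v, i), i) ∈ A' := by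
    intro u v i h
    rw [hA']
    exact Or.inl ⟨u, v, i, h, rfl⟩
  clear hA'
  induction hp generalizing i₁ with
  | nil => exact absurd rfl hne
  | @cons u v w i p h hp ih =>
    have hb := hA _ h
    simp only [List.map_cons, List.head?_cons, Option.some.injEq] at hfirst
    subst hfirst
    cases hp with
    | nil =>
      simp at hlast
      subst hlast
      refine ⟨_, ArcPath.cons (hi _ _ _ h) (ArcPath.nil _), ?_⟩
      have : i ≠ 0 := by simp at hb; omega
      simp [this]
    | @cons _ v' _ j p h' hp =>
      have hb' := hA _ h'
      simp only [List.map_cons] at hmono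
      have hm := List.isChain_cons_cons.1 hmono
      obtain ⟨q, hq, he⟩ := ih (by simp) hm.2 j (by simp)
        (by simpa [List.getLast?_cons_cons] using hlast)
      simp only at hb hb'
      obtain ⟨d, rfl⟩ := Nat.exists_eq_add_of_le hm.1
      obtain ⟨q', hq', he'⟩ := loss_extend m A' hl v _ d i q hb.1 hb'.2 hq
      refine ⟨_, ArcPath.cons (hi _ _ _ h) hq', ?_⟩
      have h0 : i ≠ 0 := by omega
      rw [List.map_cons, List.filter_cons_of_pos (by simpa using h0), he', he]
      simp
end

section
/- Fix a capacity W ∈ ℕ and item sizes w₁, …, w_m with 1 ≤ w_i ≤ W for all i. Consider the directed graph on vertex set {0, 1, …, W} with, for each item i and each k with k + w_i ≤ W, an item arc from k to k + w_i labeled i, and, for each 0 ≤ k < W, a loss arc from k to k + 1. Then for every a : Fin m → ℕ, there exists a directed path from 0 to W that uses exactly a(i) item arcs labeled i for each i if and only if Σ_i a(i)·w_i ≤ W. Hence the paths from 0 to W of this graph represent exactly the valid packing patterns of a bin of capacity W. -/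
/-- Paths from `0` to `W` of the one-dimensional arc-flow graph (item arcs from `k` to
`k + wᵢ` labeled `i + 1`, loss arcs from `k` to `k + 1` labeled `0`) represent exactly
the valid packing patterns of a bin of capacity `W`: there is a path from `0` to `W`
using exactly `a i` item arcs labeled `i + 1` for each `i` iff `∑ i, a i * w i ≤ W`. -/
theorem arcflow_paths_are_patterns (W m : ℕ) (w : Fin m → ℕ)
    (hw : ∀ i, 1 ≤ w i ∧ w i ≤ W)
    (E : Set (ℕ × ℕ × ℕ))
    (hE : E = {x | (∃ i : Fin m, x.2.2 = (i : ℕ) + 1 ∧ x.2.1 = x.1 + w i ∧ x.2.1 ≤ W) ∨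
                   (x.2.2 = 0 ∧ x.2.1 = x.1 + 1 ∧ x.2.1 ≤ W)})
    (a : Fin m → ℕ) :
    (∃ p : List (ℕ × ℕ × ℕ), ArcPath E 0 W p ∧
        ∀ i : Fin m, (p.filter (fun x => decide (x.2.2 = (i : ℕ) + 1))).length = a i)
      ↔ ∑ i, a i * w i ≤ W := by
  subst hE
  set E : Set (ℕ × ℕ × ℕ) :=
    {x | (∃ i : Fin m, x.2.2 = (i : ℕ) + 1 ∧ x.2.1 = x.1 + w i ∧ x.2.1 ≤ W) ∨
                   (x.2.2 = 0 ∧ x.2.1 = x.1 + 1 ∧ x.2.1 ≤ W)} with hE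
  constructor
  · rintro ⟨p, hp, ha⟩
    have key : ∀ u v p, ArcPath E u v p →
        u + ∑ i : Fin m, (p.filter (fun x => decide (x.2.2 = (i : ℕ) + 1))).length * w i ≤ v := by
      intro u v p hp
      induction hp with
      | nil v => simp
      | @cons u v x l p h hp ih =>
        rcases h with ⟨j, h1, h2, h3⟩ | ⟨h1, h2, h3⟩
        · simp only at h1 h2 h3
          subst h1 h2
          have : ∀ i : Fin m, (((u, u + w j, (j : ℕ) + 1) :: p).filter
              (fun x => decide (x.2.2 = (i : ℕ) + 1))).length * w i
              = (if j = i then w i else 0)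
                + (p.filter (fun x => decide (x.2.2 = (i : ℕ) + 1))).length * w i := by
            intro i
            by_cases hji : j = i
            · subst hji
              simp
              ring
            · have : (j : ℕ) ≠ i := fun h => hji (Fin.ext h)
              simp [hji, this]
          simp only [this, Finset.sum_add_distrib, Finset.sum_ite_eq, Finset.mem_univ, if_true]
          omega
        · simp only at h1 h2 h3
          subst h1 h2
          have : ∀ i : Fin m, ((u, u + 1, 0) :: p).filter
              (fun x => decide (x.2.2 = (i : ℕ) + 1))
              = p.filter (fun x => decide (x.2.2 = (i : ℕ) + 1)) := by
            intro i
            simp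
          simp only [this]
          omega
    have := key 0 W p hp
    simp only [ha] at this
    omega
  · have key : ∀ n u (a : Fin m → ℕ), u + n = W → ∑ i, a i * w i ≤ n →
        ∃ p : List (ℕ × ℕ × ℕ), ArcPath E u W p ∧
        ∀ i : Fin m, (p.filter (fun x => decide (x.2.2 = (i : ℕ) + 1))).length = a i := by
      intro n
      induction n using Nat.strong_induction_on with
      | _ n ih =>
        intro u a hu hs
        by_cases h : ∃ j, a j ≠ 0
        · obtain ⟨j, hj⟩ := h
          have hsum : ∑ i, a i * w i = w j + ∑ i, (if i = j then a i - 1 else a i) * w i := by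
            have : ∀ i, a i * w i
                = (if j = i then w i else 0) + (if i = j then a i - 1 else a i) * w i := by
              intro i
              by_cases hij : i = j
              · subst hij
                obtain ⟨k, hk⟩ := Nat.exists_eq_succ_of_ne_zero hj
                simp [hk]
                ring
              · simp [hij, Ne.symm hij]
            rw [Finset.sum_congr rfl (fun i _ => this i), Finset.sum_add_distrib]
            simp
          have hwj := (hw j).1
          obtain ⟨p, hp, hc⟩ := ih (n - w j) (by omega) (u + w j)
            (fun i => if i = j then a i - 1 else a i) (by omega) (by omega)
          refine ⟨(u, u + w j, (j : ℕ) + 1) :: p,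
            ArcPath.cons (Or.inl ⟨j, rfl, rfl, by simp only; omega⟩) hp, ?_⟩
          intro i
          have hci := hc i
          by_cases hij : i = j
          · subst hij
            simp at hci ⊢
            omega
          · have : (j : ℕ) ≠ i := fun h => hij (Fin.ext h.symm)
            simp [hij, this] at hci ⊢
            exact hci
        · push Not at h
          rcases Nat.eq_zero_or_pos n with h0 | h0
          · subst h0
            have : u = W := by omega
            subst this
            exact ⟨[], ArcPath.nil _, by simp [h]⟩
          · obtain ⟨p, hp, hc⟩ := ih (n - 1) (by omega) (u + 1) a (by omega) (by simp [h])
            refine ⟨(u, u + 1, 0) :: p,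
              ArcPath.cons (Or.inr ⟨rfl, rfl, by simp only; omega⟩) hp, ?_⟩
            intro i
            simpa using hc i
    intro h
    exact key W 0 a (by omega) h
end

section
/- Let J be a finite index set, a : Fin m → J → ℕ a matrix of pattern coefficients, b : Fin m → ℕ a demand vector, and x : J → ℝ a vector with x_j ≥ 0 for all j and Σ_{j ∈ J} a_i(j)·x_j ≥ b_i for every i ∈ Fin m. If the number of indices j with x_j not an integer is at most m, then the integer vector y defined by y_j = ⌈x_j⌉ also satisfies Σ_{j ∈ J} a_i(j)·y_j ≥ b_i for every i, and Σ_{j ∈ J} y_j ≤ Σ_{j ∈ J} x_j + m. Hence rounding up the fractional variables of a solution of the linear relaxation of the pattern model yields an integer feasible solution of value at most the fractional value plus m. -/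
/-- Rounding up the fractional variables of a feasible solution of the linear relaxation
of the pattern model yields an integer feasible solution whose value exceeds the
fractional value by at most `m`, provided at most `m` variables are fractional. -/
theorem rounding_up_lp_solution {J : Type} [Fintype J] (m : ℕ)
    (a : Fin m → J → ℕ) (b : Fin m → ℕ) (x : J → ℝ)
    (hx : ∀ j, 0 ≤ x j)
    (hfeas : ∀ i, (b i : ℝ) ≤ ∑ j, (a i j : ℝ) * x j)
    (hfrac : {j : J | ¬ ∃ n : ℤ, x j = (n : ℝ)}.ncard ≤ m) :
    (∀ i, (b i : ℝ) ≤ ∑ j, (a i j : ℝ) * (⌈x j⌉ : ℝ)) ∧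
    (∑ j, (⌈x j⌉ : ℝ)) ≤ (∑ j, x j) + m := by
  classical
  refine ⟨fun i => (hfeas i).trans (Finset.sum_le_sum fun j _ =>
    mul_le_mul_of_nonneg_left (Int.le_ceil _) (Nat.cast_nonneg _)), ?_⟩
  have key : ∀ j, (⌈x j⌉ : ℝ) ≤ x j + if (¬ ∃ n : ℤ, x j = (n : ℝ)) then (1 : ℝ) else 0 := by
    intro j
    split_ifs with h
    · obtain ⟨n, hn⟩ := h
      rw [hn, Int.ceil_intCast, add_zero]
    · exact (Int.ceil_lt_add_one (x j)).le
  have hcard : (∑ j, if (¬ ∃ n : ℤ, x j = (n : ℝ)) then (1 : ℝ) else 0) ≤ m := by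
    rw [Finset.sum_boole]
    rw [Set.ncard_eq_toFinset_card', Set.toFinset_ofPred] at hfrac
    exact_mod_cast hfrac
  calc (∑ j, (⌈x j⌉ : ℝ))
      ≤ ∑ j, (x j + if (¬ ∃ n : ℤ, x j = (n : ℝ)) then (1 : ℝ) else 0) :=
        Finset.sum_le_sum fun j _ => key j
    _ ≤ (∑ j, x j) + m := by
        rw [Finset.sum_add_distrib]
        linarith
end

section
/- Let G be a finite directed acyclic multigraph with distinguished vertices s ≠ t whose arcs carry labels in {0, 1, …, m} (label 0 marking loss arcs). For a directed path P from s to t and 1 ≤ i ≤ m, let n_i(P) be the number of arcs of P with label i; for an integer flow f, let use_i(f) be the sum of f over all arcs with label i. Let b : Fin m → ℕ and z ∈ ℕ. Then there exists an integer flow f of value z with use_i(f) ≥ b_i for all i if and only if there exists a multiset 𝒫 of exactly z directed paths from s to t with Σ_{P ∈ 𝒫} n_i(P) ≥ b_i for all i. Consequently, the arc-flow model and the pattern model whose patterns are the s–t paths of G have equal optimal values. -/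
theorem Multigraph.sum_count_filter {A : Type} [Fintype A] [DecidableEq A]
    (Q : A → Prop) [DecidablePred Q] (p : List A) :
    ∑ a ∈ Finset.univ.filter Q, p.count a = (p.filter (fun a => decide (Q a))).length := by
  induction p with
  | nil => simp
  | cons x p ih =>
    simp only [List.count_cons, Finset.sum_add_distrib, ih]
    by_cases h : Q x <;> simp [h, Finset.sum_ite_eq, beq_iff_eq]

theorem Multigraph.sum_count_multiset {A : Type} [Fintype A] [DecidableEq A]
    (Q : A → Prop) [DecidablePred Q] (P : Multiset (List A)) :
    ∑ a ∈ Finset.univ.filter Q, (P.map (fun p => p.count a)).sum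
      = (P.map (fun p => (p.filter (fun a => decide (Q a))).length)).sum := by
  induction P using Multiset.induction_on with
  | empty => simp
  | cons p P ih =>
    simp only [Multiset.map_cons, Multiset.sum_cons, Finset.sum_add_distrib, ih,
      Multigraph.sum_count_filter]

theorem Multigraph.Walk.balance {V A : Type} [DecidableEq V] {G : Multigraph V A} {u w : V}
    {p : List A} (h : G.Walk u w p) (v : V) :
    (p.filter (fun a => decide (G.head a = v))).length + (if u = v then 1 else 0)
      = (p.filter (fun a => decide (G.tail a = v))).length + (if w = v then 1 else 0) := by
  induction h with
  | nil x => simp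
  | cons ht hh hp ih =>
    subst ht hh
    simp only [List.filter_cons, decide_eq_true_eq]
    split_ifs at * <;> simp_all <;> omega

theorem Multigraph.balance_multiset {V A : Type} [DecidableEq V] {G : Multigraph V A} {s t : V}
    (P : Multiset (List A)) (h : ∀ p ∈ P, G.Walk s t p) (v : V) :
    (P.map (fun p => (p.filter (fun a => decide (G.head a = v))).length)).sum
        + (if s = v then Multiset.card P else 0)
      = (P.map (fun p => (p.filter (fun a => decide (G.tail a = v))).length)).sum
        + (if t = v then Multiset.card P else 0) := by
  induction P using Multiset.induction_on with
  | empty => simp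
  | cons p P ih =>
    have h1 := ih (fun q hq => h q (Multiset.mem_cons_of_mem hq))
    have h2 := (h p (Multiset.mem_cons_self p P)).balance v
    simp only [Multiset.map_cons, Multiset.sum_cons, Multiset.card_cons]
    split_ifs at * <;> omega

theorem Multigraph.Walk.append {V A : Type} {G : Multigraph V A} {u v w : V}
    {p q : List A} (h : G.Walk u v p) (h' : G.Walk v w q) : G.Walk u w (p ++ q) := by
  induction h with
  | nil x => exact h'
  | cons ht hh hp ih => exact .cons ht hh (ih h')

theorem Multigraph.Walk.prefix_of_mem {V A : Type} {G : Multigraph V A} {u w : V}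
    {p : List A} (h : G.Walk u w p) (a : A) (ha : a ∈ p) : ∃ q, G.Walk u (G.tail a) q := by
  induction h with
  | nil x => simp at ha
  | cons ht hh hp ih =>
    rcases List.mem_cons.1 ha with rfl | ha
    · exact ⟨[], ht ▸ .nil _⟩
    · obtain ⟨q, hq⟩ := ih ha
      exact ⟨_, .cons ht hh hq⟩

theorem Multigraph.Walk.nodup {V A : Type} {G : Multigraph V A}
    (hacyc : ∀ (v : V) (p : List A), G.Walk v v p → p = []) {u w : V}
    {p : List A} (h : G.Walk u w p) : p.Nodup := by
  induction h with
  | nil x => simp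
  | cons ht hh hp ih =>
    refine List.nodup_cons.2 ⟨fun ha => ?_, ih⟩
    obtain ⟨q, hq⟩ := hp.prefix_of_mem _ ha
    have := hacyc _ _ (Multigraph.Walk.cons rfl hh hq)
    simp at this

theorem Multigraph.exists_walk {V A : Type} [Fintype V] [Fintype A] [DecidableEq V]
    (G : Multigraph V A)
    (hacyc : ∀ (v : V) (p : List A), G.Walk v v p → p = []) (D : V → Prop) (f : A → ℕ)
    (hf : ∀ w, ¬ D w → ∑ a ∈ Finset.univ.filter (fun a => G.head a = w), f a
        ≤ ∑ a ∈ Finset.univ.filter (fun a => G.tail a = w), f a) (u : V)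
    (hu : 0 < ∑ a ∈ Finset.univ.filter (fun a => G.tail a = u), f a) :
    ∃ w p, D w ∧ G.Walk u w p ∧ ∀ a ∈ p, 0 < f a := by
  let R : V → V → Prop := fun v u => ∃ p, p ≠ [] ∧ G.Walk u v p
  haveI : IsTrans V R := ⟨by
    rintro x y z ⟨p, hp, h⟩ ⟨q, hq, h'⟩
    exact ⟨q ++ p, by simp [hp], h'.append h⟩⟩
  haveI : Std.Irrefl R := ⟨by
    rintro x ⟨p, hp, h⟩
    exact hp (hacyc _ _ h)⟩
  have wf : WellFounded R := Finite.wellFounded_of_trans_of_irrefl R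
  induction u using wf.induction with
  | _ u ih =>
    obtain ⟨a, ha, hfa⟩ := Finset.exists_ne_zero_of_sum_ne_zero hu.ne'
    simp only [Finset.mem_filter, Finset.mem_univ, true_and] at ha
    have hfa' : 0 < f a := Nat.pos_of_ne_zero hfa
    have hw : G.Walk u (G.head a) [a] := .cons ha rfl (.nil _)
    by_cases hD : D (G.head a)
    · exact ⟨_, _, hD, hw, by simpa using hfa'⟩
    · have h1 : f a ≤ ∑ a' ∈ Finset.univ.filter (fun a' => G.head a' = G.head a), f a' :=
        Finset.single_le_sum (f := f) (fun _ _ => Nat.zero_le _) (by simp)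
      obtain ⟨w, p, hDw, hp, hpos⟩ := ih (G.head a) ⟨_, by simp, hw⟩
        (by have := hf _ hD; omega)
      refine ⟨w, a :: p, hDw, .cons ha rfl hp, ?_⟩
      intro x hx
      rcases List.mem_cons.1 hx with rfl | hx
      · exact hfa'
      · exact hpos x hx

theorem Multigraph.decompose {V A : Type} [Fintype V] [Fintype A]
    [DecidableEq V] [DecidableEq A]
    (G : Multigraph V A) (s t : V) (hst : s ≠ t)
    (hacyc : ∀ (v : V) (p : List A), G.Walk v v p → p = []) (z : ℕ) : ∀ f : A → ℕ,
      (∀ v : V, ∑ a ∈ Finset.univ.filter (fun a => G.head a = v), f a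
          + (if s = v then z else 0)
          = ∑ a ∈ Finset.univ.filter (fun a => G.tail a = v), f a
          + (if t = v then z else 0)) →
      ∃ P : Multiset (List A), Multiset.card P = z ∧ (∀ p ∈ P, G.Walk s t p) ∧
        ∀ a, f a = (P.map (fun p => p.count a)).sum := by
  induction z with
  | zero =>
    intro f hf
    refine ⟨0, by simp, by simp, fun a => ?_⟩
    by_contra hne
    have h1 : f a ≤ ∑ a' ∈ Finset.univ.filter (fun a' => G.tail a' = G.tail a), f a' :=
      Finset.single_le_sum (f := f) (fun _ _ => Nat.zero_le _) (by simp)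
    simp only [Multiset.map_zero, Multiset.sum_zero] at hne
    obtain ⟨w, p, hD, -⟩ := G.exists_walk hacyc (fun _ => False) f
      (fun w _ => by have := hf w; simp at this; omega) (G.tail a) (by omega)
    exact hD
  | succ z ih =>
    intro f hf
    obtain ⟨w, p, rfl, hp, hpos⟩ := G.exists_walk hacyc (fun w => w = t) f
      (fun w hw => by
        have := hf w
        rw [if_neg (Ne.symm hw)] at this
        omega) s (by
        have := hf s
        rw [if_pos rfl, if_neg hst.symm] at this
        omega)
    have hnd := hp.nodup hacyc
    have hle : ∀ a, p.count a ≤ f a := by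
      intro a
      by_cases ha : a ∈ p
      · have := hpos a ha
        have := List.nodup_iff_count_le_one.1 hnd a
        omega
      · simp [List.count_eq_zero_of_not_mem ha]
    obtain ⟨g, hg⟩ : ∃ g : A → ℕ, f = fun a => g a + p.count a :=
      ⟨fun a => f a - p.count a, funext fun a => (Nat.sub_add_cancel (hle a)).symm⟩
    subst hg
    obtain ⟨P, hc, hP, hgP⟩ := ih g (fun v => by
      have h1 := hf v
      have h2 := hp.balance v
      simp only [Finset.sum_add_distrib, Multigraph.sum_count_filter] at h1
      split_ifs at * <;> omega)
    refine ⟨p ::ₘ P, by simp [hc], ?_, fun a => ?_⟩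
    · intro q hq
      rcases Multiset.mem_cons.1 hq with rfl | hq
      · exact hp
      · exact hP q hq
    · simp [hgP a, add_comm]

/-- Equivalence of the arc-flow model and the pattern model whose patterns are the
`s`–`t` paths of a finite labeled DAG: there is an integer flow of value `z` using at
least `b i` arcs of each item label `i + 1` iff there is a multiset of exactly `z`
directed `s`–`t` paths whose total number of arcs with label `i + 1` is at least `b i`
for every item `i`. -/
theorem arcflow_pattern_equivalence {V A : Type} [Fintype V] [Fintype A]
    [DecidableEq V] [DecidableEq A]
    (G : Multigraph V A) (s t : V) (hst : s ≠ t)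
    (hacyc : ∀ (v : V) (p : List A), G.Walk v v p → p = [])
    (m : ℕ) (ℓ : A → ℕ) (hℓ : ∀ a, ℓ a ≤ m)
    (b : Fin m → ℕ) (z : ℕ) :
    (∃ f : A → ℕ,
      (∀ v : V, v ≠ s → v ≠ t →
        ∑ a ∈ Finset.univ.filter (fun a => G.head a = v), f a
          = ∑ a ∈ Finset.univ.filter (fun a => G.tail a = v), f a) ∧
      (∑ a ∈ Finset.univ.filter (fun a => G.tail a = s), f a
          = ∑ a ∈ Finset.univ.filter (fun a => G.head a = s), f a + z) ∧
      (∑ a ∈ Finset.univ.filter (fun a => G.head a = t), f a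
          = ∑ a ∈ Finset.univ.filter (fun a => G.tail a = t), f a + z) ∧
      (∀ i : Fin m, b i ≤ ∑ a ∈ Finset.univ.filter (fun a => ℓ a = (i : ℕ) + 1), f a))
    ↔
    (∃ P : Multiset (List A), Multiset.card P = z ∧
      (∀ p ∈ P, G.Walk s t p) ∧
      (∀ i : Fin m,
        b i ≤ (P.map (fun p =>
          (p.filter (fun a => decide (ℓ a = (i : ℕ) + 1))).length)).sum)) := by
  constructor
  · rintro ⟨f, h1, h2, h3, h4⟩
    obtain ⟨P, hc, hP, hfP⟩ := G.decompose s t hst hacyc z f (fun v => by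
      by_cases hs : s = v
      · subst hs
        rw [if_pos rfl, if_neg hst.symm]
        omega
      · by_cases ht : t = v
        · subst ht
          rw [if_pos rfl, if_neg hst]
          omega
        · rw [if_neg hs, if_neg ht, h1 v (Ne.symm hs) (Ne.symm ht)])
    refine ⟨P, hc, hP, fun i => ?_⟩
    rw [← Multigraph.sum_count_multiset]
    refine (h4 i).trans (le_of_eq (Finset.sum_congr rfl fun a _ => hfP a))
  · rintro ⟨P, rfl, hP, h⟩
    have hb := Multigraph.balance_multiset P hP
    refine ⟨fun a => (P.map (fun p => p.count a)).sum, ?_, ?_, ?_, ?_⟩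
    · intro v hs ht
      have := hb v
      rw [if_neg hs.symm, if_neg ht.symm] at this
      simpa only [Multigraph.sum_count_multiset, add_zero] using this
    · have := hb s
      rw [if_pos rfl, if_neg hst.symm] at this
      simp only [Multigraph.sum_count_multiset]
      omega
    · have := hb t
      rw [if_pos rfl, if_neg hst] at this
      simp only [Multigraph.sum_count_multiset]
      omega
    · intro i
      rw [Multigraph.sum_count_multiset]
      exact h i
end
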